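/- Let R ≥ 4, ‖A‖ ≤ R (spectral norm), ‖x‖_2 ≤ R, ‖y‖_2 ≤ R, ‖b‖_1 ≤ 1, β ∈ (0, 0.1), and suppose ⟨exp(Ax) + Ax, 1_n⟩ ≥ β and ⟨exp(Ay) + Ay, 1_n⟩ ≥ β. Then the Hessian H(x) = ∇²L(x) of the loss L(x) = 0.5·‖⟨exp(Ax) + Ax, 1_n⟩^{-1}·(exp(Ax) + Ax) − b‖_2² is Lipschitz in the sense that ‖H(x) − H(y)‖ ≤ 20β^{-5}·n^{3.5}·exp(8R²)·‖x − y‖_2, where ‖H(x) − H(y)‖ is the spectral norm. -/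

import Mathlib

open Matrix

/-- Euclidean (ℓ₂) norm of a vector in ℝ^m. -/
noncomputable def vecNorm2 {m : ℕ} (v : Fin m → ℝ) : ℝ := Real.sqrt (∑ i, (v i) ^ 2)

/-- ℓ₁ norm of a vector in ℝ^m. -/
noncomputable def vecNorm1 {m : ℕ} (v : Fin m → ℝ) : ℝ := ∑ i, |v i|

/-- Spectral norm of a matrix: operator norm of the induced map between Euclidean spaces. -/
noncomputable def specNorm {m k : ℕ} (A : Matrix (Fin m) (Fin k) ℝ) : ℝ :=
  ‖(Matrix.toEuclideanLin A).toContinuousLinearMap‖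

/-- Loewner order: `U ⪯ V` iff `vᵀ U v ≤ vᵀ V v` for all vectors `v`. -/
def loewnerLE {m : ℕ} (U V : Matrix (Fin m) (Fin m) ℝ) : Prop :=
  ∀ v : Fin m → ℝ, v ⬝ᵥ (U *ᵥ v) ≤ v ⬝ᵥ (V *ᵥ v)

variable {n d : ℕ}

/-- `exp(Ax)`, the entrywise exponential of `A x`. -/
noncomputable def expv (A : Matrix (Fin n) (Fin d) ℝ) (x : Fin d → ℝ) : Fin n → ℝ :=
  fun j => Real.exp (A.mulVec x j)

/-- `u(x) = exp(Ax) + Ax`. -/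
noncomputable def uf (A : Matrix (Fin n) (Fin d) ℝ) (x : Fin d → ℝ) : Fin n → ℝ :=
  fun j => expv A x j + A.mulVec x j

/-- `α(x) = ⟨u(x), 1_n⟩`. -/
noncomputable def alphaf (A : Matrix (Fin n) (Fin d) ℝ) (x : Fin d → ℝ) : ℝ :=
  ∑ j, uf A x j

/-- `f(x) = α(x)⁻¹ u(x)`. -/
noncomputable def ff (A : Matrix (Fin n) (Fin d) ℝ) (x : Fin d → ℝ) : Fin n → ℝ :=
  (alphaf A x)⁻¹ • uf A x

/-- `v_i(x) = (exp(Ax) + 1_n) ∘ A_{*,i}`. -/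
noncomputable def vf (A : Matrix (Fin n) (Fin d) ℝ) (i : Fin d) (x : Fin d → ℝ) : Fin n → ℝ :=
  fun j => (expv A x j + 1) * A j i

/-- `c(x) = f(x) - b`. -/
noncomputable def cf (A : Matrix (Fin n) (Fin d) ℝ) (b : Fin n → ℝ) (x : Fin d → ℝ) : Fin n → ℝ :=
  fun j => ff A x j - b j

/-- `L(x) = 0.5 ‖c(x)‖₂²`. -/
noncomputable def Lf (A : Matrix (Fin n) (Fin d) ℝ) (b : Fin n → ℝ) (x : Fin d → ℝ) : ℝ :=
  0.5 * ∑ j, (cf A b x j) ^ 2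

/-- `z(x) = exp(Ax) + 1_n`. -/
noncomputable def zf (A : Matrix (Fin n) (Fin d) ℝ) (x : Fin d → ℝ) : Fin n → ℝ :=
  fun j => expv A x j + 1

/-- `K(x) = I_n - f(x) · 1_nᵀ`. -/
noncomputable def Kf (A : Matrix (Fin n) (Fin d) ℝ) (x : Fin d → ℝ) : Matrix (Fin n) (Fin n) ℝ :=
  1 - vecMulVec (ff A x) (fun _ => 1)

/-- `c̃(x) = K(x)ᵀ c(x)`. -/
noncomputable def ctf (A : Matrix (Fin n) (Fin d) ℝ) (b : Fin n → ℝ) (x : Fin d → ℝ) : Fin n → ℝ :=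
  (Kf A x)ᵀ *ᵥ cf A b x

/-- `B_mat(x) = α(x)⁻² diag(z(x)) K(x)ᵀ K(x) diag(z(x))`. -/
noncomputable def Bmat (A : Matrix (Fin n) (Fin d) ℝ) (x : Fin d → ℝ) : Matrix (Fin n) (Fin n) ℝ :=
  ((alphaf A x) ^ 2)⁻¹ • (diagonal (zf A x) * (Kf A x)ᵀ * Kf A x * diagonal (zf A x))

/-- `B_rank(x) = α(x)⁻² (z(x) c̃(x)ᵀ diag(z(x)) + diag(z(x)) c̃(x) z(x)ᵀ)`. -/
noncomputable def Brank (A : Matrix (Fin n) (Fin d) ℝ) (b : Fin n → ℝ) (x : Fin d → ℝ) :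
    Matrix (Fin n) (Fin n) ℝ :=
  ((alphaf A x) ^ 2)⁻¹ •
    (vecMulVec (zf A x) (ctf A b x) * diagonal (zf A x)
      + diagonal (zf A x) * vecMulVec (ctf A b x) (zf A x))

/-- `B_diag(x) = α(x)⁻¹ diag(c̃(x) ∘ exp(Ax))`. -/
noncomputable def Bdiag (A : Matrix (Fin n) (Fin d) ℝ) (b : Fin n → ℝ) (x : Fin d → ℝ) :
    Matrix (Fin n) (Fin n) ℝ :=
  (alphaf A x)⁻¹ • diagonal (fun j => ctf A b x j * expv A x j)

/-- `B(x) = B_mat(x) - B_rank(x) + B_diag(x)`. -/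
noncomputable def Bf (A : Matrix (Fin n) (Fin d) ℝ) (b : Fin n → ℝ) (x : Fin d → ℝ) :
    Matrix (Fin n) (Fin n) ℝ :=
  Bmat A x - Brank A b x + Bdiag A b x

/-- Hessian matrix of the loss `L`, with `H(x)_{ij} = ∂²L/∂x_i∂x_j`. -/
noncomputable def Hf (A : Matrix (Fin n) (Fin d) ℝ) (b : Fin n → ℝ) (x : Fin d → ℝ) :
    Matrix (Fin d) (Fin d) ℝ :=
  Matrix.of fun i j =>
    fderiv ℝ (fun y => fderiv ℝ (Lf A b) y (Pi.single j 1)) x (Pi.single i 1)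

section helpers
variable {n d : ℕ} (A : Matrix (Fin n) (Fin d) ℝ) (b : Fin n → ℝ)

/-- Jacobian of `f` with respect to `A x`. -/
noncomputable def Phi (x : Fin d → ℝ) (k m : Fin n) : ℝ :=
  (alphaf A x)⁻¹ * ((if k = m then 1 else 0) - ff A x k) * zf A x m

/-- gradient in terms of `A x` -/
noncomputable def gg (x : Fin d → ℝ) (m : Fin n) : ℝ := ∑ k, cf A b x k * Phi A x k m

/-- modified residual -/
noncomputable def ct (x : Fin d → ℝ) (m : Fin n) : ℝ :=
  cf A b x m - ∑ k, cf A b x k * ff A x k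

/-- Hessian in terms of `A x` -/
noncomputable def BB (x : Fin d → ℝ) : Matrix (Fin n) (Fin n) ℝ := Matrix.of fun m l =>
  (∑ k, Phi A x k m * Phi A x k l) - (alphaf A x)⁻¹ * zf A x m * gg A b x l
    - (alphaf A x)⁻¹ * zf A x l * gg A b x m
    + (if m = l then 1 else 0) * ((alphaf A x)⁻¹ * expv A x m * ct A b x m)

theorem hd_t (x v : Fin d → ℝ) (k : Fin n) :
    HasDerivAt (fun τ : ℝ => (A *ᵥ (x + τ • v)) k) ((A *ᵥ v) k) 0 := by
  have : (fun τ : ℝ => (A *ᵥ (x + τ • v)) k) = fun τ : ℝ => (A *ᵥ x) k + τ * (A *ᵥ v) k := by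
    funext τ
    simp [Matrix.mulVec_add, Matrix.mulVec_smul]
  rw [this]
  simpa using ((hasDerivAt_id (0:ℝ)).mul_const ((A *ᵥ v) k)).const_add ((A *ᵥ x) k)

theorem hd_e (x v : Fin d → ℝ) (k : Fin n) :
    HasDerivAt (fun τ : ℝ => expv A (x + τ • v) k) (expv A x k * (A *ᵥ v) k) 0 := by
  simpa [expv] using (hd_t A x v k).exp

theorem hd_z (x v : Fin d → ℝ) (k : Fin n) :
    HasDerivAt (fun τ : ℝ => zf A (x + τ • v) k) (expv A x k * (A *ᵥ v) k) 0 := by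
  simpa [zf] using (hd_e A x v k).add_const 1

theorem hd_u (x v : Fin d → ℝ) (k : Fin n) :
    HasDerivAt (fun τ : ℝ => uf A (x + τ • v) k) (zf A x k * (A *ᵥ v) k) 0 := by
  refine HasDerivAt.congr_deriv ((hd_e A x v k).fun_add (hd_t A x v k)) ?_
  simp only [zf]; ring

theorem hd_a (x v : Fin d → ℝ) :
    HasDerivAt (fun τ : ℝ => alphaf A (x + τ • v)) (∑ k, zf A x k * (A *ᵥ v) k) 0 := by
  exact HasDerivAt.fun_sum (fun k _ => hd_u A x v k)

theorem hd_s (x v : Fin d → ℝ) (h : alphaf A x ≠ 0) :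
    HasDerivAt (fun τ : ℝ => (alphaf A (x + τ • v))⁻¹)
      (-(alphaf A x)⁻¹ * ((alphaf A x)⁻¹ * ∑ k, zf A x k * (A *ᵥ v) k)) 0 := by
  refine HasDerivAt.congr_deriv ((hd_a A x v).fun_inv (by simpa using h)) ?_
  simp; field_simp

theorem Phi_sum (x : Fin d → ℝ) (w : Fin n → ℝ) (k : Fin n) :
    ∑ m, Phi A x k m * w m =
      (alphaf A x)⁻¹ * (zf A x k * w k - ff A x k * ∑ m, zf A x m * w m) := by
  simp only [Phi, mul_sub, sub_mul, Finset.sum_sub_distrib, Finset.mul_sum]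
  congr 1
  · rw [Finset.sum_eq_single k]
    · simp; ring
    · intro m _ hm; simp [Ne.symm hm]
    · simp
  · refine Finset.sum_congr rfl fun m _ => by ring

theorem hd_f (x v : Fin d → ℝ) (h : alphaf A x ≠ 0) (k : Fin n) :
    HasDerivAt (fun τ : ℝ => ff A (x + τ • v) k) (∑ m, Phi A x k m * (A *ᵥ v) m) 0 := by
  rw [Phi_sum]
  refine HasDerivAt.congr_deriv ((hd_s A x v h).fun_mul (hd_u A x v k)) ?_
  simp [ff]; ring

theorem hd_c (x v : Fin d → ℝ) (h : alphaf A x ≠ 0) (k : Fin n) :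
    HasDerivAt (fun τ : ℝ => cf A b (x + τ • v) k) (∑ m, Phi A x k m * (A *ᵥ v) m) 0 := by
  simpa [cf] using (hd_f A x v h k).sub_const (b k)

theorem swap1 (c w : Fin n → ℝ) (P : Fin n → Fin n → ℝ) :
    ∑ m, (∑ k, c k * P k m) * w m = ∑ k, c k * ∑ m, P k m * w m := by
  simp only [Finset.sum_mul, Finset.mul_sum]
  rw [Finset.sum_comm]
  simp only [mul_assoc]

theorem hd_L (x v : Fin d → ℝ) (h : alphaf A x ≠ 0) :
    HasDerivAt (fun τ : ℝ => Lf A b (x + τ • v)) (∑ m, gg A b x m * (A *ᵥ v) m) 0 := by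
  have := (HasDerivAt.fun_sum (u := Finset.univ)
    (fun k _ => (hd_c A b x v h k).fun_pow 2)).const_mul (0.5:ℝ)
  refine this.congr_deriv ?_
  symm
  simp only [gg]
  rw [swap1, Finset.mul_sum]
  refine Finset.sum_congr rfl fun k _ => ?_
  simp; ring

/-- `F k` : derivative of `f k`, as function of x for a fixed `w`. -/
theorem hd_F (x v : Fin d → ℝ) (w : Fin n → ℝ) (h : alphaf A x ≠ 0) (k : Fin n) :
    HasDerivAt (fun τ : ℝ => ∑ m, Phi A (x + τ • v) k m * w m)
      (-((alphaf A x)⁻¹ * ∑ m, zf A x m * (A *ᵥ v) m) * (∑ m, Phi A x k m * w m)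
        + (alphaf A x)⁻¹ * (expv A x k * (A *ᵥ v) k * w k)
        - (alphaf A x)⁻¹ * (∑ m, Phi A x k m * (A *ᵥ v) m) * (∑ m, zf A x m * w m)
        - (alphaf A x)⁻¹ * ff A x k * ∑ m, expv A x m * (A *ᵥ v) m * w m) 0 := by
  simp only [Phi_sum A _ w]
  have hz : HasDerivAt (fun τ : ℝ => ∑ m, zf A (x + τ • v) m * w m)
      (∑ m, expv A x m * (A *ᵥ v) m * w m) 0 :=
    HasDerivAt.fun_sum (fun m _ => (hd_z A x v m).mul_const (w m))
  refine HasDerivAt.congr_deriv ((hd_s A x v h).fun_mul (((hd_z A x v k).mul_const (w k)).fun_sub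
    ((hd_f A x v h k).fun_mul hz))) ?_
  simp; ring

theorem hd_G (x v : Fin d → ℝ) (w : Fin n → ℝ) (h : alphaf A x ≠ 0) :
    HasDerivAt (fun τ : ℝ => ∑ m, gg A b (x + τ • v) m * w m)
      (∑ m, ∑ l, (A *ᵥ v) m * BB A b x m l * w l) 0 := by
  simp only [gg, swap1]
  refine (HasDerivAt.fun_sum (u := Finset.univ)
    (fun k _ => (hd_c A b x v h k).fun_mul (hd_F A x v w h k))).congr_deriv ?_
  symm
  simp only [zero_smul, add_zero]
  generalize A *ᵥ v = w'
  have e1 : ∑ m, ∑ l, w' m * (∑ k, Phi A x k m * Phi A x k l) * w l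
      = ∑ k, (∑ m, Phi A x k m * w' m) * ∑ l, Phi A x k l * w l := by
    simp only [Finset.sum_mul, Finset.mul_sum]
    rw [Finset.sum_comm]
    rw [Finset.sum_congr rfl fun l _ => Finset.sum_comm]
    rw [Finset.sum_comm]
    refine Finset.sum_congr rfl fun k _ => ?_
    refine Finset.sum_congr rfl fun l _ => ?_
    refine Finset.sum_congr rfl fun m _ => ?_
    ring
  have e2 : ∑ m, gg A b x m * w m = ∑ k, cf A b x k * ∑ m, Phi A x k m * w m := swap1 _ _ _
  have e2' : ∑ m, gg A b x m * w' m = ∑ k, cf A b x k * ∑ m, Phi A x k m * w' m := swap1 _ _ _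
  have e3 : ∑ m, ∑ l, w' m * BB A b x m l * w l =
      (∑ m, ∑ l, w' m * (∑ k, Phi A x k m * Phi A x k l) * w l)
      - (alphaf A x)⁻¹ * (∑ m, zf A x m * w' m) * (∑ l, gg A b x l * w l)
      - (alphaf A x)⁻¹ * (∑ m, gg A b x m * w' m) * (∑ l, zf A x l * w l)
      + (alphaf A x)⁻¹ * ∑ m, expv A x m * ct A b x m * w' m * w m := by
    rw [mul_assoc, mul_assoc, Finset.sum_mul_sum, Finset.sum_mul_sum]
    simp only [Finset.mul_sum]
    rw [← Finset.sum_sub_distrib, ← Finset.sum_sub_distrib, ← Finset.sum_add_distrib]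
    refine Finset.sum_congr rfl fun m _ => ?_
    have : (alphaf A x)⁻¹ * (expv A x m * ct A b x m * w' m * w m) =
      ∑ l, (if m = l then (alphaf A x)⁻¹ * (expv A x m * ct A b x m * w' m * w l) else 0) := by
      simp
    rw [this, ← Finset.sum_sub_distrib, ← Finset.sum_sub_distrib, ← Finset.sum_add_distrib]
    refine Finset.sum_congr rfl fun l _ => ?_
    simp only [BB, Matrix.of_apply, ← Finset.mul_sum, ← Finset.sum_mul]
    split_ifs <;> ring
  have e4 : ∑ m, expv A x m * ct A b x m * w' m * w m =
     (∑ m, cf A b x m * (expv A x m * w' m * w m))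
      - (∑ k, cf A b x k * ff A x k) * ∑ m, expv A x m * w' m * w m := by
    rw [Finset.mul_sum, ← Finset.sum_sub_distrib]
    refine Finset.sum_congr rfl fun m _ => ?_
    simp only [ct]; ring
  rw [e3, e1, e2, e2', e4]
  simp only [mul_sub, mul_add, Finset.sum_add_distrib, Finset.sum_sub_distrib]
  generalize ∑ m, zf A x m * w' m = p
  generalize ∑ m, zf A x m * w m = q
  generalize ∑ m, expv A x m * w' m * w m = r
  have h1 : ∀ g : Fin n → ℝ, ∑ k, cf A b x k * (-((alphaf A x)⁻¹ * p) * g k)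
     = - ((alphaf A x)⁻¹ * p) * ∑ k, cf A b x k * g k := by
    intro g; rw [Finset.mul_sum]; exact Finset.sum_congr rfl fun _ _ => by ring
  have h2 : ∀ g : Fin n → ℝ, ∑ k, cf A b x k * ((alphaf A x)⁻¹ * g k)
     = (alphaf A x)⁻¹ * ∑ k, cf A b x k * g k := by
    intro g; rw [Finset.mul_sum]; exact Finset.sum_congr rfl fun _ _ => by ring
  have h3 : ∀ g : Fin n → ℝ, ∑ k, cf A b x k * ((alphaf A x)⁻¹ * g k * q)
     = (alphaf A x)⁻¹ * (∑ k, cf A b x k * g k) * q := by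
    intro g; rw [Finset.mul_sum, Finset.sum_mul]; exact Finset.sum_congr rfl fun _ _ => by ring
  have h4 : ∀ g : Fin n → ℝ, ∑ k, cf A b x k * ((alphaf A x)⁻¹ * g k * r)
     = (alphaf A x)⁻¹ * ((∑ k, cf A b x k * g k) * r) := by
    intro g; rw [Finset.sum_mul, Finset.mul_sum]; exact Finset.sum_congr rfl fun _ _ => by ring
  rw [h1 (fun k => ∑ m, Phi A x k m * w m), h2 (fun k => expv A x k * w' k * w k),
    h3 (fun k => ∑ m, Phi A x k m * w' m), h4 (fun k => ff A x k)]
  ring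

theorem da_t (k : Fin n) : Differentiable ℝ (fun x : Fin d → ℝ => (A *ᵥ x) k) := by
  unfold Matrix.mulVec dotProduct
  fun_prop

theorem da_e (k : Fin n) : Differentiable ℝ (fun x : Fin d → ℝ => expv A x k) := by
  have := da_t A k
  unfold expv
  fun_prop

theorem da_a : Differentiable ℝ (alphaf A) := by
  have := fun k => da_t A k
  have := fun k => da_e A k
  unfold alphaf uf
  fun_prop

theorem da_c (k : Fin n) (x : Fin d → ℝ) (h : alphaf A x ≠ 0) :
    DifferentiableAt ℝ (fun x : Fin d → ℝ => cf A b x k) x := by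
  have h1 := da_t A k x
  have h2 := da_e A k x
  have h3 : DifferentiableAt ℝ (fun x => (alphaf A x)⁻¹) x := (da_a A x).fun_inv h
  simp only [cf, ff, uf, Pi.smul_apply, smul_eq_mul]
  fun_prop

theorem da_L (x : Fin d → ℝ) (h : alphaf A x ≠ 0) : DifferentiableAt ℝ (Lf A b) x := by
  have := fun k => da_c A b k x h
  unfold Lf
  fun_prop

theorem da_G (w : Fin n → ℝ) (x : Fin d → ℝ) (h : alphaf A x ≠ 0) :
    DifferentiableAt ℝ (fun x => ∑ m, gg A b x m * w m) x := by
  have h1 := fun k => da_c A b k x h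
  have h0 := fun k => da_c A 0 k x h
  have h2 := fun k => da_e A k x
  have h3 : DifferentiableAt ℝ (fun x => (alphaf A x)⁻¹) x := (da_a A x).fun_inv h
  simp only [cf, Pi.zero_apply, sub_zero] at h0
  simp only [gg, Phi, zf]
  fun_prop

theorem fd_L (x v : Fin d → ℝ) (h : alphaf A x ≠ 0) :
    fderiv ℝ (Lf A b) x v = ∑ m, gg A b x m * (A *ᵥ v) m := by
  have h1 : HasLineDerivAt ℝ (Lf A b) _ x v := (da_L A b x h).hasFDerivAt.hasLineDerivAt v
  exact HasDerivAt.unique h1 (hd_L A b x v h)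

theorem Hf_eq (x : Fin d → ℝ) (h : alphaf A x ≠ 0) : Hf A b x = Aᵀ * BB A b x * A := by
  ext i j
  simp only [Hf, Matrix.of_apply]
  have hev : (fun y => fderiv ℝ (Lf A b) y (Pi.single j 1)) =ᶠ[nhds x]
      fun y => ∑ m, gg A b y m * (A *ᵥ (Pi.single j 1)) m := by
    filter_upwards [(da_a A).continuous.continuousAt.eventually_ne h] with y hy
    exact fd_L A b y _ hy
  rw [hev.fderiv_eq]
  have h1 : HasLineDerivAt ℝ (fun y => ∑ m, gg A b y m * (A *ᵥ (Pi.single j 1)) m) _ x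
    (Pi.single i 1) := (da_G A b _ x h).hasFDerivAt.hasLineDerivAt _
  rw [HasDerivAt.unique h1 (hd_G A b x _ _ h)]
  simp only [Matrix.mul_apply, Matrix.mulVec_single_one, Matrix.col_apply, Matrix.transpose_apply,
    Finset.sum_mul]
  rw [Finset.sum_comm]
end helpers

section bounds

/-- `p, q` bounded by `M` and close to each other relative to `M`. -/
def BL (D p q M k : ℝ) : Prop := |p| ≤ M ∧ |q| ≤ M ∧ |p - q| ≤ k * M * D

theorem BL.mono {D p q M k M' k' : ℝ} (hD : 0 ≤ D) (hk : 0 ≤ k) (h : BL D p q M k) (hM : M ≤ M')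
    (hkk : k ≤ k') : BL D p q M' k' := by
  obtain ⟨h1, h2, h3⟩ := h
  have hM0 : 0 ≤ M := (abs_nonneg _).trans h1
  refine ⟨h1.trans hM, h2.trans hM, h3.trans ?_⟩
  gcongr
  exact hk.trans hkk

theorem BL.mul {D p q M k p' q' M' k' : ℝ} (h : BL D p q M k)
    (h' : BL D p' q' M' k') : BL D (p * p') (q * q') (M * M') (k + k') := by
  obtain ⟨h1, h2, h3⟩ := h
  obtain ⟨h1', h2', h3'⟩ := h'
  have hM0 : 0 ≤ M := (abs_nonneg _).trans h1
  have hM0' : 0 ≤ M' := (abs_nonneg _).trans h1'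
  refine ⟨?_, ?_, ?_⟩
  · rw [abs_mul]; gcongr
  · rw [abs_mul]; gcongr
  · have : p * p' - q * q' = p * (p' - q') + (p - q) * q' := by ring
    rw [this]
    refine (abs_add_le _ _).trans ?_
    rw [abs_mul, abs_mul]
    calc |p| * |p' - q'| + |p - q| * |q'| ≤ M * (k' * M' * D) + (k * M * D) * M' := by
          gcongr
          exact (abs_nonneg _).trans h3
      _ = _ := by ring

theorem BL.add {D p q M k p' q' M' : ℝ} (h : BL D p q M k)
    (h' : BL D p' q' M' k) : BL D (p + p') (q + q') (M + M') k := by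
  obtain ⟨h1, h2, h3⟩ := h
  obtain ⟨h1', h2', h3'⟩ := h'
  refine ⟨(abs_add_le _ _).trans (by gcongr), (abs_add_le _ _).trans (by gcongr), ?_⟩
  have : p + p' - (q + q') = (p - q) + (p' - q') := by ring
  rw [this]
  refine (abs_add_le _ _).trans ?_
  linarith

theorem BL.neg {D p q M k : ℝ} (h : BL D p q M k) : BL D (-p) (-q) M k := by
  obtain ⟨h1, h2, h3⟩ := h
  refine ⟨by rwa [abs_neg], by rwa [abs_neg], ?_⟩
  rw [← abs_neg]
  convert h3 using 2
  ring

theorem BL.sub {D p q M k p' q' M' : ℝ} (h : BL D p q M k)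
    (h' : BL D p' q' M' k) : BL D (p - p') (q - q') (M + M') k := by
  rw [sub_eq_add_neg, sub_eq_add_neg]
  exact h.add h'.neg

theorem BL.sum {n : ℕ} {D M k : ℝ} {p q : Fin n → ℝ} (h : ∀ i, BL D (p i) (q i) M k) :
    BL D (∑ i, p i) (∑ i, q i) (n * M) k := by
  have key : ∀ (f : Fin n → ℝ) (C : ℝ), (∀ i, |f i| ≤ C) → |∑ i, f i| ≤ n * C := by
    intro f C hf
    refine (Finset.abs_sum_le_sum_abs _ _).trans ?_
    refine (Finset.sum_le_sum fun i _ => hf i).trans ?_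
    simp
  refine ⟨key _ _ fun i => (h i).1, key _ _ fun i => (h i).2.1, ?_⟩
  rw [← Finset.sum_sub_distrib]
  refine (key _ _ fun i => (h i).2.2).trans (le_of_eq (by ring))

theorem BL.const {D p M : ℝ} (h : |p| ≤ M) : BL D p p M 0 := ⟨h, h, by simp⟩

theorem exp_lip {a b r : ℝ} (ha : a ≤ r) (hb : b ≤ r) :
    |Real.exp a - Real.exp b| ≤ Real.exp r * |a - b| := by
  wlog hab : b ≤ a generalizing a b
  · rw [abs_sub_comm, abs_sub_comm a b]
    exact this hb ha (le_of_not_ge hab)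
  rw [abs_of_nonneg (sub_nonneg.2 (Real.exp_le_exp.2 hab)), abs_of_nonneg (sub_nonneg.2 hab)]
  have h1 : Real.exp b = Real.exp a * Real.exp (b - a) := by rw [← Real.exp_add]; ring_nf
  have h2 := Real.add_one_le_exp (b - a)
  have h3 : Real.exp a ≤ Real.exp r := Real.exp_le_exp.2 ha
  have h4 := Real.exp_pos a
  calc Real.exp a - Real.exp b ≤ Real.exp a * (a - b) := by rw [h1]; nlinarith
    _ ≤ _ := by gcongr

theorem vecNorm2_eq {m : ℕ} (v : Fin m → ℝ) : vecNorm2 v = ‖WithLp.toLp 2 v‖ := by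
  simp [vecNorm2, EuclideanSpace.norm_eq]

theorem mulVec_bound {n d : ℕ} (A : Matrix (Fin n) (Fin d) ℝ) (v : Fin d → ℝ) (k : Fin n) :
    |(A *ᵥ v) k| ≤ specNorm A * vecNorm2 v := by
  have h1 := (Matrix.toEuclideanLin A).toContinuousLinearMap.le_opNorm (WithLp.toLp 2 v)
  rw [← vecNorm2_eq v] at h1
  refine le_trans ?_ h1
  have := PiLp.norm_apply_le (p := 2)
    ((Matrix.toEuclideanLin A).toContinuousLinearMap (WithLp.toLp 2 v)) k
  simpa [Matrix.toLpLin_apply] using this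

theorem specNorm_entry {n : ℕ} (M : Matrix (Fin n) (Fin n) ℝ) (C : ℝ) (hC : 0 ≤ C)
    (h : ∀ i j, |M i j| ≤ C) : specNorm M ≤ n * C := by
  refine ContinuousLinearMap.opNorm_le_bound _ (by positivity) fun v => ?_
  rw [EuclideanSpace.norm_eq]
  refine Real.sqrt_le_iff.2 ⟨by positivity, ?_⟩
  have hv : ‖v‖ ^ 2 = ∑ j, v j ^ 2 := by
    rw [EuclideanSpace.norm_sq_eq]; simp
  have : ∀ i, ‖((Matrix.toEuclideanLin M).toContinuousLinearMap v) i‖ ^ 2 ≤ n * C ^ 2 * ‖v‖ ^ 2 := by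
    intro i
    have e : ((Matrix.toEuclideanLin M).toContinuousLinearMap v) i = ∑ j, M i j * v j := by
      simp [Matrix.toLpLin_apply, Matrix.mulVec, dotProduct]
    rw [e, Real.norm_eq_abs, sq_abs, hv]
    refine (Finset.sum_mul_sq_le_sq_mul_sq _ _ _).trans ?_
    gcongr
    calc ∑ j, M i j ^ 2 ≤ ∑ j : Fin n, C ^ 2 :=
          Finset.sum_le_sum fun j _ => sq_le_sq' (by linarith [neg_abs_le (M i j), h i j])
            ((le_abs_self _).trans (h i j))
      _ = n * C ^ 2 := by simp
  refine (Finset.sum_le_sum fun i _ => this i).trans ?_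
  simp only [Finset.sum_const, Finset.card_univ, Fintype.card_fin, nsmul_eq_mul]
  apply le_of_eq; ring

open scoped Matrix.Norms.L2Operator in
theorem specNorm_conj {n d : ℕ} (A : Matrix (Fin n) (Fin d) ℝ) (M : Matrix (Fin n) (Fin n) ℝ) :
    specNorm (Aᵀ * M * A) ≤ specNorm A * specNorm M * specNorm A := by
  have hs : ∀ {a b : ℕ} (N : Matrix (Fin a) (Fin b) ℝ), specNorm N = ‖N‖ := fun N => rfl
  rw [hs, hs, hs]
  have ht : ‖Aᵀ‖ = ‖A‖ := by
    rw [← Matrix.l2_opNorm_conjTranspose A, Matrix.conjTranspose_eq_transpose_of_trivial]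
  calc ‖Aᵀ * M * A‖ ≤ ‖Aᵀ * M‖ * ‖A‖ := Matrix.l2_opNorm_mul _ _
    _ ≤ ‖Aᵀ‖ * ‖M‖ * ‖A‖ := by gcongr; exact Matrix.l2_opNorm_mul _ _
    _ = _ := by rw [ht]

theorem BB_BL {n d : ℕ} (A : Matrix (Fin n) (Fin d) ℝ) (b : Fin n → ℝ) (x y : Fin d → ℝ)
    (r δ β : ℝ) (hr : 1 ≤ r) (hn : (1:ℝ) ≤ n) (hδ : 0 ≤ δ) (hβ0 : 0 < β) (hβ1 : β ≤ 1)
    (hx : ∀ k, |(A *ᵥ x) k| ≤ r) (hy : ∀ k, |(A *ᵥ y) k| ≤ r)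
    (hxy : ∀ k, |(A *ᵥ x) k - (A *ᵥ y) k| ≤ δ)
    (hb : ∀ k, |b k| ≤ 1) (hβx : β ≤ alphaf A x) (hβy : β ≤ alphaf A y) (m l : Fin n) :
    BL (2 * β⁻¹ * n * Real.exp r * δ) (BB A b x m l) (BB A b y m l)
      (117 * n * Real.exp r ^ 4 * β⁻¹ ^ 4) 8 := by
  set E := Real.exp r with hE
  set s := β⁻¹ with hs
  set D := 2 * s * n * E * δ with hDdef
  have hs1 : 1 ≤ s := (one_le_inv₀ hβ0).2 hβ1
  have hE2 : r + 1 ≤ E := Real.add_one_le_exp r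
  have hE1 : 1 ≤ E := by linarith
  have hEs : 1 ≤ E * s := one_le_mul_of_one_le_of_one_le hE1 hs1
  have hnE : 1 ≤ n * E := one_le_mul_of_one_le_of_one_le hn hE1
  have hD : 0 ≤ D := by positivity
  have hδD : δ ≤ D := by
    have : 1 ≤ s * (n * E) := one_le_mul_of_one_le_of_one_le hs1 hnE
    rw [hDdef]; nlinarith
  have ht : ∀ k, BL D ((A *ᵥ x) k) ((A *ᵥ y) k) E 1 := fun k =>
    ⟨(hx k).trans (by linarith), (hy k).trans (by linarith), (hxy k).trans (by nlinarith)⟩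
  have helip : ∀ k, |expv A x k - expv A y k| ≤ E * δ := fun k =>
    (exp_lip ((le_abs_self _).trans (hx k)) ((le_abs_self _).trans (hy k))).trans (by
      gcongr; exact hxy k)
  have he : ∀ k, BL D (expv A x k) (expv A y k) E 1 := fun k => by
    refine ⟨?_, ?_, (helip k).trans (by rw [one_mul]; gcongr)⟩
    · rw [expv, abs_of_pos (Real.exp_pos _)]
      exact Real.exp_le_exp.2 ((le_abs_self _).trans (hx k))
    · rw [expv, abs_of_pos (Real.exp_pos _)]
      exact Real.exp_le_exp.2 ((le_abs_self _).trans (hy k))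
  have hu : ∀ k, BL D (uf A x k) (uf A y k) (2 * E) 1 := fun k => by
    have := (he k).add (ht k)
    rwa [← two_mul] at this
  have hz : ∀ k, BL D (zf A x k) (zf A y k) (2 * E) 1 := fun k =>
    ((he k).add ((BL.const (le_of_eq abs_one)).mono hD le_rfl le_rfl zero_le_one)).mono hD
      zero_le_one (by linarith) le_rfl
  have hax : 0 < alphaf A x := hβ0.trans_le hβx
  have hay : 0 < alphaf A y := hβ0.trans_le hβy
  have hα : |alphaf A x - alphaf A y| ≤ n * (2 * E * δ) := by
    simp only [alphaf]
    rw [← Finset.sum_sub_distrib]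
    refine (Finset.abs_sum_le_sum_abs _ _).trans ?_
    refine (Finset.sum_le_sum (g := fun _ => 2 * E * δ) fun k _ => ?_).trans (by simp)
    have : uf A x k - uf A y k = (expv A x k - expv A y k) + ((A *ᵥ x) k - (A *ᵥ y) k) := by
      simp only [uf]; ring
    rw [this]
    refine (abs_add_le _ _).trans ?_
    have h1 := helip k
    have h2 := hxy k
    nlinarith
  have hsx : (alphaf A x)⁻¹ ≤ s := inv_anti₀ hβ0 hβx
  have hsy : (alphaf A y)⁻¹ ≤ s := inv_anti₀ hβ0 hβy
  have hsi : BL D (alphaf A x)⁻¹ (alphaf A y)⁻¹ s 1 := by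
    refine ⟨by rwa [abs_of_pos (inv_pos.2 hax)], by rwa [abs_of_pos (inv_pos.2 hay)], ?_⟩
    have : (alphaf A x)⁻¹ - (alphaf A y)⁻¹ =
      (alphaf A x)⁻¹ * (alphaf A y)⁻¹ * (-(alphaf A x - alphaf A y)) := by
      field_simp; ring
    rw [this, abs_mul, abs_neg, abs_of_pos (by positivity)]
    calc _ ≤ s * s * (n * (2 * E * δ)) := by gcongr
      _ = _ := by rw [hDdef]; ring
  have hf : ∀ k, BL D (ff A x k) (ff A y k) (2 * E * s) 2 := fun k =>
    (hsi.mul (hu k)).mono hD (by norm_num) (by linarith) (by norm_num)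
  have hc : ∀ k, BL D (cf A b x k) (cf A b y k) (3 * E * s) 2 := fun k =>
    ((hf k).sub ((BL.const (hb k)).mono hD le_rfl le_rfl zero_le_two)).mono hD
      zero_le_two (by linarith) le_rfl
  have hI : ∀ (p : Prop) [Decidable p], |(if p then 1 else 0 : ℝ)| ≤ 1 := by
    intro p _; split_ifs <;> simp
  have hPhi : ∀ k m, BL D (Phi A x k m) (Phi A y k m) (6 * E ^ 2 * s ^ 2) 4 := fun k m => by
    refine ((hsi.mul (((BL.const (hI (k = m))).mono hD le_rfl le_rfl zero_le_two).sub
      (hf k))).mul (hz m)).mono hD (by norm_num) ?_ (by norm_num)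
    calc s * (1 + 2 * E * s) * (2 * E) ≤ s * (E * s + 2 * E * s) * (2 * E) := by gcongr
      _ = _ := by ring
  have hg : ∀ m, BL D (gg A b x m) (gg A b y m) (18 * n * E ^ 3 * s ^ 3) 6 := fun m =>
    (BL.sum fun k => (hc k).mul (hPhi k m)).mono hD (by norm_num) (le_of_eq (by ring))
      (by norm_num)
  have hct : ∀ m, BL D (ct A b x m) (ct A b y m) (9 * n * E ^ 2 * s ^ 2) 4 := fun m => by
    refine (((hc m).mono hD (by norm_num) le_rfl (by norm_num : (2:ℝ) ≤ 2 + 2)).sub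
      (BL.sum fun k => (hc k).mul (hf k))).mono hD (by norm_num) ?_ (by norm_num)
    have h1 : (E * s) * 1 ≤ (E * s) * (n * (E * s)) := by
      gcongr; exact one_le_mul_of_one_le_of_one_le hn hEs
    nlinarith
  have h1 : BL D (∑ k, Phi A x k m * Phi A x k l) (∑ k, Phi A y k m * Phi A y k l)
      (36 * n * E ^ 4 * s ^ 4) 8 :=
    (BL.sum fun k => (hPhi k m).mul (hPhi k l)).mono hD (by norm_num) (le_of_eq (by ring))
      (by norm_num)
  have h2 : ∀ m l, BL D ((alphaf A x)⁻¹ * zf A x m * gg A b x l)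
      ((alphaf A y)⁻¹ * zf A y m * gg A b y l) (36 * n * E ^ 4 * s ^ 4) 8 := fun m l =>
    ((hsi.mul (hz m)).mul (hg l)).mono hD (by norm_num) (le_of_eq (by ring)) (by norm_num)
  have h3 : BL D ((if m = l then 1 else 0) * ((alphaf A x)⁻¹ * expv A x m * ct A b x m))
      ((if m = l then 1 else 0) * ((alphaf A y)⁻¹ * expv A y m * ct A b y m))
      (9 * n * E ^ 4 * s ^ 4) 8 := by
    refine ((BL.const (hI (m = l))).mul ((hsi.mul (he m)).mul (hct m))).mono hD (by norm_num) ?_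
      (by norm_num)
    calc 1 * (s * E * (9 * n * E ^ 2 * s ^ 2)) = 9 * n * E ^ 3 * s ^ 3 * 1 := by ring
      _ ≤ 9 * n * E ^ 3 * s ^ 3 * (E * s) := by gcongr
      _ = _ := by ring
  have := ((h1.sub (h2 m l)).sub (h2 l m)).add h3
  exact this.mono hD (by norm_num) (le_of_eq (by ring)) le_rfl

end bounds

/-- the Hessian of the loss is Lipschitz:
‖H(x) − H(y)‖ ≤ 20β⁻⁵·n^{3.5}·exp(8R²)·‖x − y‖₂. -/
theorem stmt19 (n d : ℕ) (A : Matrix (Fin n) (Fin d) ℝ) (b : Fin n → ℝ) (x y : Fin d → ℝ)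
    (R β : ℝ) (hR : 4 ≤ R) (hA : specNorm A ≤ R) (hx : vecNorm2 x ≤ R) (hy : vecNorm2 y ≤ R)
    (hb : vecNorm1 b ≤ 1) (hβ0 : 0 < β) (hβ1 : β < 0.1)
    (hβx : β ≤ alphaf A x) (hβy : β ≤ alphaf A y) :
    specNorm (Hf A b x - Hf A b y)
      ≤ 20 * (β ^ 5)⁻¹ * (n : ℝ) ^ (3.5 : ℝ) * Real.exp (8 * R ^ 2) * vecNorm2 (x - y) := by
  have hn : (1:ℝ) ≤ n := by
    rcases Nat.eq_zero_or_pos n with h0 | h0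
    · subst h0
      simp [alphaf] at hβx
      linarith
    · exact_mod_cast h0
  have hβ1' : β ≤ 1 := hβ1.le.trans (by norm_num)
  have hR0 : 0 ≤ R := by linarith
  have hA0 : 0 ≤ specNorm A := norm_nonneg _
  have hV : ∀ v : Fin d → ℝ, 0 ≤ vecNorm2 v := fun v => Real.sqrt_nonneg _
  have hbd : ∀ v : Fin d → ℝ, vecNorm2 v ≤ R → ∀ k, |(A *ᵥ v) k| ≤ R ^ 2 := fun v hv k => by
    refine (mulVec_bound A v k).trans ?_
    rw [sq]
    exact mul_le_mul hA hv (hV v) hR0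
  set N := vecNorm2 (x - y) with hN
  have hN0 : 0 ≤ N := hV _
  have hxy : ∀ k, |(A *ᵥ x) k - (A *ᵥ y) k| ≤ R * N := fun k => by
    have := mulVec_bound A (x - y) k
    rw [Matrix.mulVec_sub] at this
    exact this.trans (by gcongr)
  have hb' : ∀ k, |b k| ≤ 1 := fun k => le_trans
    (Finset.single_le_sum (f := fun k => |b k|) (fun i _ => abs_nonneg _) (Finset.mem_univ k)) hb
  have key := fun m l => (BB_BL A b x y (R ^ 2) (R * N) β (by nlinarith) hn (by positivity) hβ0 hβ1'
    (hbd x hx) (hbd y hy) hxy hb' hβx hβy m l).2.2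
  rw [Hf_eq A b x (hβ0.trans_le hβx).ne', Hf_eq A b y (hβ0.trans_le hβy).ne',
    ← Matrix.sub_mul, ← Matrix.mul_sub]
  refine (specNorm_conj A _).trans ?_
  have hB := specNorm_entry (BB A b x - BB A b y) _ (by positivity) key
  have hB0 : 0 ≤ specNorm (BB A b x - BB A b y) := norm_nonneg _
  set E := Real.exp (R ^ 2) with hE
  have hE0 : 0 < E := Real.exp_pos _
  have hE8 : Real.exp (8 * R ^ 2) = E ^ 8 := by
    rw [hE, ← Real.exp_nat_mul]; norm_num
  have hE32 : 32 * R ≤ E := by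
    have h1 := Real.quadratic_le_exp_of_nonneg (sq_nonneg R)
    rw [← hE] at h1
    have h2 : (16:ℝ) ≤ R ^ 2 := by nlinarith
    nlinarith
  have hE3 : 1872 * R ^ 3 ≤ 20 * E ^ 3 := by
    have h1 : (32 * R) ^ 3 ≤ E ^ 3 := by gcongr
    have h2 : 0 ≤ R ^ 3 := by positivity
    nlinarith
  have hnn : (n:ℝ) ^ 3 ≤ (n : ℝ) ^ (3.5 : ℝ) := by
    rw [← Real.rpow_natCast]
    exact Real.rpow_le_rpow_of_exponent_le hn (by norm_num)
  rw [hE8]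
  calc specNorm A * specNorm (BB A b x - BB A b y) * specNorm A
      ≤ R * (n * (8 * (117 * n * E ^ 4 * β⁻¹ ^ 4) * (2 * β⁻¹ * n * E * (R * N)))) * R := by
        gcongr
    _ = (1872 * R ^ 3) * ((n:ℝ) ^ 3 * (E ^ 5 * β⁻¹ ^ 5 * N)) := by ring
    _ ≤ (20 * E ^ 3) * ((n : ℝ) ^ (3.5 : ℝ) * (E ^ 5 * β⁻¹ ^ 5 * N)) := by gcongr
    _ = _ := by rw [inv_pow]; ring
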